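/- Any two minimizers of the sparse group lasso objective give the same fitted values and positively proportional nonzero blocks: if β¹ and β² both minimize L₁ over ℝᵖ, then Xβ¹ = Xβ², and for any group k with β¹_k ≠ 0 and β²_k ≠ 0 there exists c > 0 with β¹_k = c · β²_k. -/

import Mathlib

/-- The fitted values `Xβ` for a column-wise grouped design matrix
`X = (X₁ … X_K)` with `X k : ℝ^{n × p k}` and blockwise coefficients `β`. -/
noncomputable def fitted {n K : ℕ} {p : Fin K → ℕ}
    (X : ∀ k, Matrix (Fin n) (Fin (p k)) ℝ) (β : ∀ k, Fin (p k) → ℝ)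
    (i : Fin n) : ℝ :=
  ∑ k, ∑ j, X k i j * β k j

/-- The sum of the groupwise Euclidean norms `Σ_k ‖β_k‖₂`. -/
noncomputable def groupNormSum {K : ℕ} {p : Fin K → ℕ}
    (β : ∀ k, Fin (p k) → ℝ) : ℝ :=
  ∑ k, Real.sqrt (∑ j, β k j ^ 2)

/-- The group lasso objective `L(β) = (1/2)‖y − Xβ‖₂² + λ Σ_k ‖β_k‖₂`. -/
noncomputable def groupLasso {n K : ℕ} {p : Fin K → ℕ}
    (X : ∀ k, Matrix (Fin n) (Fin (p k)) ℝ) (y : Fin n → ℝ) (lam : ℝ)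
    (β : ∀ k, Fin (p k) → ℝ) : ℝ :=
  (1 / 2) * ∑ i, (y i - fitted X β i) ^ 2 + lam * groupNormSum β


/-- The sparse group lasso objective
`L₁(β) = (1/2)‖y − Xβ‖₂² + λ₁ Σ_k ‖β_k‖₂ + λ₂ ‖β‖₁`. -/
noncomputable def sparseGroupLasso {n K : ℕ} {p : Fin K → ℕ}
    (X : ∀ k, Matrix (Fin n) (Fin (p k)) ℝ) (y : Fin n → ℝ) (lam1 lam2 : ℝ)
    (β : ∀ k, Fin (p k) → ℝ) : ℝ :=
  (1 / 2) * ∑ i, (y i - fitted X β i) ^ 2 + lam1 * groupNormSum β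
    + lam2 * ∑ k, ∑ j, |β k j|

theorem sqrt_sum_sq_eq_norm {ι : Type*} [Fintype ι] (v : ι → ℝ) :
    Real.sqrt (∑ j, v j ^ 2) = ‖WithLp.toLp 2 v‖ := by
  simp [EuclideanSpace.norm_eq]

theorem norm_midpoint_toLp_le {ι : Type*} [Fintype ι] (u v : ι → ℝ) :
    ‖WithLp.toLp 2 ((1 / 2 : ℝ) • (u + v))‖
      ≤ (‖WithLp.toLp 2 u‖ + ‖WithLp.toLp 2 v‖) / 2 := by
  rw [WithLp.toLp_smul, WithLp.toLp_add, norm_smul, Real.norm_of_nonneg (by norm_num)]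
  linarith [norm_add_le (WithLp.toLp 2 u) (WithLp.toLp 2 v)]

/-- Equality in the midpoint inequality for the Euclidean norm forces two nonzero vectors to be
positively proportional. -/
theorem exists_pos_smul_eq_of_norm_midpoint_toLp {ι : Type*} [Fintype ι] {u v : ι → ℝ}
    (hu : u ≠ 0) (hv : v ≠ 0)
    (h : ‖WithLp.toLp 2 ((1 / 2 : ℝ) • (u + v))‖
      = (‖WithLp.toLp 2 u‖ + ‖WithLp.toLp 2 v‖) / 2) :
    ∃ c : ℝ, 0 < c ∧ u = c • v := by
  rw [WithLp.toLp_smul, WithLp.toLp_add, norm_smul, Real.norm_of_nonneg (by norm_num)] at h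
  have hray : SameRay ℝ (WithLp.toLp 2 u) (WithLp.toLp 2 v) :=
    sameRay_iff_norm_add.2 (by linarith)
  obtain ⟨r, s, hr, hs, hrs⟩ := hray.exists_pos (by simpa using hu) (by simpa using hv)
  rw [← WithLp.toLp_smul, ← WithLp.toLp_smul] at hrs
  have huv : r • u = s • v := WithLp.toLp_injective 2 hrs
  refine ⟨r⁻¹ * s, by positivity, ?_⟩
  rw [mul_smul, ← huv, inv_smul_smul₀ hr.ne']

theorem fitted_midpoint {n K : ℕ} {p : Fin K → ℕ}
    (X : ∀ k, Matrix (Fin n) (Fin (p k)) ℝ) (β γ : ∀ k, Fin (p k) → ℝ) (i : Fin n) :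
    fitted X (fun k => (1 / 2 : ℝ) • (β k + γ k)) i = (fitted X β i + fitted X γ i) / 2 := by
  simp only [fitted, ← Finset.sum_add_distrib, Finset.sum_div]
  refine Finset.sum_congr rfl fun k _ => Finset.sum_congr rfl fun j _ => ?_
  simp only [Pi.smul_apply, Pi.add_apply, smul_eq_mul]
  ring

theorem sum_abs_midpoint_le {K : ℕ} {p : Fin K → ℕ} (β γ : ∀ k, Fin (p k) → ℝ) :
    ∑ k, ∑ j, |((1 / 2 : ℝ) • (β k + γ k)) j|
      ≤ (∑ k, ∑ j, |β k j| + ∑ k, ∑ j, |γ k j|) / 2 := by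
  simp only [← Finset.sum_add_distrib, Finset.sum_div]
  refine Finset.sum_le_sum fun k _ => Finset.sum_le_sum fun j _ => ?_
  rw [Pi.smul_apply, Pi.add_apply, smul_eq_mul, abs_mul, abs_of_nonneg (by norm_num)]
  linarith [abs_add_le (β k j) (γ k j)]

theorem sum_sq_sub_midpoint {ι : Type*} [Fintype ι] (y a b : ι → ℝ) :
    ∑ i, (y i - (a i + b i) / 2) ^ 2
      = (∑ i, (y i - a i) ^ 2 + ∑ i, (y i - b i) ^ 2) / 2 - (∑ i, (a i - b i) ^ 2) / 4 := by
  simp only [← Finset.sum_add_distrib, Finset.sum_div, ← Finset.sum_sub_distrib]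
  exact Finset.sum_congr rfl fun i _ => by ring

/-- Any two minimizers of the sparse group lasso objective give the same fitted
values, and their nonzero blocks are positively proportional. -/
theorem sparse_group_lasso_minimizers_fit_and_directions
    {n K : ℕ} {p : Fin K → ℕ}
    (X : ∀ k, Matrix (Fin n) (Fin (p k)) ℝ) (y : Fin n → ℝ)
    (lam1 lam2 : ℝ) (hlam1 : 0 < lam1) (hlam2 : 0 < lam2)
    (β1 β2 : ∀ k, Fin (p k) → ℝ)
    (h1 : ∀ β, sparseGroupLasso X y lam1 lam2 β1 ≤ sparseGroupLasso X y lam1 lam2 β)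
    (h2 : ∀ β, sparseGroupLasso X y lam1 lam2 β2 ≤ sparseGroupLasso X y lam1 lam2 β) :
    fitted X β1 = fitted X β2 ∧
      ∀ k : Fin K, β1 k ≠ 0 → β2 k ≠ 0 → ∃ c : ℝ, 0 < c ∧ β1 k = c • β2 k := by
  have hgap : ∀ k ∈ Finset.univ, 0 ≤ (‖WithLp.toLp 2 (β1 k)‖ + ‖WithLp.toLp 2 (β2 k)‖) / 2
      - ‖WithLp.toLp 2 ((1 / 2 : ℝ) • (β1 k + β2 k))‖ :=
    fun k _ => sub_nonneg.2 (norm_midpoint_toLp_le _ _)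
  have hsum : ∑ k, ((‖WithLp.toLp 2 (β1 k)‖ + ‖WithLp.toLp 2 (β2 k)‖) / 2
      - ‖WithLp.toLp 2 ((1 / 2 : ℝ) • (β1 k + β2 k))‖)
      = (groupNormSum β1 + groupNormSum β2) / 2
        - groupNormSum (fun k => (1 / 2 : ℝ) • (β1 k + β2 k)) := by
    simp only [groupNormSum, sqrt_sum_sq_eq_norm, Finset.sum_sub_distrib, ← Finset.sum_div,
      Finset.sum_add_distrib]
  have hgap_sum := Finset.sum_nonneg hgap
  have hfit_sum : 0 ≤ ∑ i, (fitted X β1 i - fitted X β2 i) ^ 2 :=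
    Finset.sum_nonneg fun i _ => sq_nonneg _
  have hle : (1 / 8) * ∑ i, (fitted X β1 i - fitted X β2 i) ^ 2
      + lam1 * ((groupNormSum β1 + groupNormSum β2) / 2
        - groupNormSum (fun k => (1 / 2 : ℝ) • (β1 k + β2 k))) ≤ 0 := by
    have hmid1 := h1 (fun k => (1 / 2 : ℝ) • (β1 k + β2 k))
    have hmid2 := h2 (fun k => (1 / 2 : ℝ) • (β1 k + β2 k))
    have habs := mul_le_mul_of_nonneg_left (sum_abs_midpoint_le β1 β2) hlam2.le
    simp only [sparseGroupLasso, fitted_midpoint, sum_sq_sub_midpoint] at hmid1 hmid2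
    linarith
  rw [← hsum] at hle
  have hprod := mul_nonneg hlam1.le hgap_sum
  constructor
  · have hzero : ∑ i, (fitted X β1 i - fitted X β2 i) ^ 2 = 0 := by linarith
    rw [Finset.sum_eq_zero_iff_of_nonneg fun i _ => sq_nonneg _] at hzero
    funext i
    exact sub_eq_zero.1 (pow_eq_zero_iff two_ne_zero |>.1 (hzero i (Finset.mem_univ i)))
  · intro k hk1 hk2
    have hprod_zero := le_antisymm (by linarith) hprod
    have hzero := (mul_eq_zero.1 hprod_zero).resolve_left hlam1.ne'
    rw [Finset.sum_eq_zero_iff_of_nonneg hgap] at hzero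
    exact exists_pos_smul_eq_of_norm_midpoint_toLp hk1 hk2
      (sub_eq_zero.1 (hzero k (Finset.mem_univ k))).symm
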